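/- arXiv:2305.11971 — 2 statements merged into one kernel-verified Lean document; each statement's English description precedes it below -/
import Mathlib

section
/- Let X and Y be real-valued random variables on a probability space (Ω, P). For each n ≥ 1 define S_n := min_{1≤j≤n} |X + 2|Y|·cos(πj/(n+1))| and L_n := max_{1≤j≤n} |X + 2|Y|·cos(πj/(n+1))| (these are the smallest and largest singular values of the n×n random symmetric tridiagonal Toeplitz matrix with diagonal X and off-diagonal Y). Let m := min(|X−2|Y||, |X+2|Y||), M := max(|X−2|Y||, |X+2|Y||), and W₀ := 0 if |X| ≤ 2|Y| and W₀ := m if |X| > 2|Y|. Then for all real x, y such that P(W₀ = x) = 0 (this holds automatically when x < 0): lim_{n→∞} P(S_n ≤ x, L_n ≤ y) = P(M ≤ y) − P(x < 0 ≤ M ≤ y and |X| ≤ 2|Y|) − P(x < m ≤ M ≤ y and |X| > 2|Y|). -/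
open MeasureTheory ProbabilityTheory Filter

/-- Smallest singular value of the `n × n` random symmetric tridiagonal Toeplitz matrix
with diagonal `X ω` and off-diagonal `Y ω`. -/
noncomputable def symSmin {Ω : Type*} (X Y : Ω → ℝ) (n : ℕ) (ω : Ω) : ℝ :=
  ⨅ j : (Finset.Icc 1 n : Finset ℕ),
    |X ω + 2 * |Y ω| * Real.cos (Real.pi * ((j : ℕ) : ℝ) / ((n : ℝ) + 1))|

/-- Largest singular value of the `n × n` random symmetric tridiagonal Toeplitz matrix
with diagonal `X ω` and off-diagonal `Y ω`. -/
noncomputable def symSmax {Ω : Type*} (X Y : Ω → ℝ) (n : ℕ) (ω : Ω) : ℝ :=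
  ⨆ j : (Finset.Icc 1 n : Finset ℕ),
    |X ω + 2 * |Y ω| * Real.cos (Real.pi * ((j : ℕ) : ℝ) / ((n : ℝ) + 1))|

theorem exists_seq_tendsto_cos {t : ℝ} (ht : t ∈ Set.Icc (-1 : ℝ) 1) :
    ∃ j : ℕ → ℕ, (∀ n, 1 ≤ n → j n ∈ Finset.Icc 1 n) ∧
      Tendsto (fun n : ℕ => Real.cos (Real.pi * ((j n : ℕ) : ℝ) / ((n : ℝ) + 1)))
        atTop (nhds t) := by
  set s : ℝ := Real.arccos t / Real.pi with hs
  have hs0 : 0 ≤ s := div_nonneg (Real.arccos_nonneg t) Real.pi_pos.le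
  have hs1 : s ≤ 1 := (div_le_one Real.pi_pos).2 (Real.arccos_le_pi t)
  refine ⟨fun n => max 1 ⌈s * n⌉₊, fun n hn => ?_, ?_⟩
  · rw [Finset.mem_Icc]
    refine ⟨le_max_left _ _, max_le hn (Nat.ceil_le.2 ?_)⟩
    exact mul_le_of_le_one_left (Nat.cast_nonneg n) hs1
  · have hinv : Tendsto (fun n : ℕ => 1 / ((n : ℝ) + 1)) atTop (nhds 0) :=
      tendsto_one_div_add_atTop_nhds_zero_nat
    have hj : Tendsto (fun n : ℕ => ((max 1 ⌈s * n⌉₊ : ℕ) : ℝ) / ((n : ℝ) + 1))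
        atTop (nhds s) := by
      have hlo : Tendsto (fun n : ℕ => s - s * (1 / ((n : ℝ) + 1))) atTop (nhds s) := by
        simpa using tendsto_const_nhds.sub (hinv.const_mul s)
      have hhi : Tendsto (fun n : ℕ => s + (1 - s) * (1 / ((n : ℝ) + 1))) atTop (nhds s) := by
        simpa using tendsto_const_nhds.add (hinv.const_mul (1 - s))
      refine tendsto_of_tendsto_of_tendsto_of_le_of_le hlo hhi (fun n => ?_) (fun n => ?_)
      · have hn : (0 : ℝ) < (n : ℝ) + 1 := by positivity
        have h1 : s * n ≤ ((max 1 ⌈s * n⌉₊ : ℕ) : ℝ) :=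
          (Nat.le_ceil _).trans (by exact_mod_cast le_max_right _ _)
        have h2 : s - s * (1 / ((n : ℝ) + 1)) = s * n / ((n : ℝ) + 1) := by
          field_simp
          ring
        simp only [h2]
        gcongr
      · have hn : (0 : ℝ) < (n : ℝ) + 1 := by positivity
        have hsn : 0 ≤ s * n := mul_nonneg hs0 (Nat.cast_nonneg n)
        have h1 : ((max 1 ⌈s * n⌉₊ : ℕ) : ℝ) ≤ s * n + 1 := by
          rw [Nat.cast_max]
          exact max_le (by simpa using hsn) (Nat.ceil_lt_add_one hsn).le
        have h2 : s + (1 - s) * (1 / ((n : ℝ) + 1)) = (s * n + 1) / ((n : ℝ) + 1) := by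
          field_simp
          ring
        simp only [h2]
        gcongr
    have hpi : Real.pi * s = Real.arccos t := by
      rw [hs]
      field_simp
    have := (Real.continuous_cos.tendsto _).comp (hj.const_mul Real.pi)
    rw [hpi, Real.cos_arccos ht.1 ht.2] at this
    refine this.congr fun n => ?_
    simp only [Function.comp_apply, mul_div_assoc]

theorem tendsto_iInf_abs_add_mul_cos {a b w t : ℝ} (ht : t ∈ Set.Icc (-1 : ℝ) 1)
    (hwt : |a + b * t| = w) (hw : ∀ s ∈ Set.Icc (-1 : ℝ) 1, w ≤ |a + b * s|) :
    Tendsto (fun n : ℕ => ⨅ j : (Finset.Icc 1 n : Finset ℕ),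
      |a + b * Real.cos (Real.pi * ((j : ℕ) : ℝ) / ((n : ℝ) + 1))|) atTop (nhds w) := by
  obtain ⟨j, hj, hlim⟩ := exists_seq_tendsto_cos ht
  have hup := ((hlim.const_mul b).const_add a).abs
  rw [hwt] at hup
  refine tendsto_of_tendsto_of_tendsto_of_le_of_le' tendsto_const_nhds hup ?_ ?_
  · filter_upwards [eventually_ge_atTop 1] with n hn
    have : Nonempty (Finset.Icc 1 n : Finset ℕ) := ⟨⟨j n, hj n hn⟩⟩
    exact le_ciInf fun i => hw _ (Real.cos_mem_Icc _)
  · filter_upwards [eventually_ge_atTop 1] with n hn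
    exact ciInf_le (Set.finite_range fun i : (Finset.Icc 1 n : Finset ℕ) =>
      |a + b * Real.cos (Real.pi * ((i : ℕ) : ℝ) / ((n : ℝ) + 1))|).bddBelow ⟨j n, hj n hn⟩

theorem tendsto_iSup_abs_add_mul_cos {a b w t : ℝ} (ht : t ∈ Set.Icc (-1 : ℝ) 1)
    (hwt : |a + b * t| = w) (hw : ∀ s ∈ Set.Icc (-1 : ℝ) 1, |a + b * s| ≤ w) :
    Tendsto (fun n : ℕ => ⨆ j : (Finset.Icc 1 n : Finset ℕ),
      |a + b * Real.cos (Real.pi * ((j : ℕ) : ℝ) / ((n : ℝ) + 1))|) atTop (nhds w) := by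
  obtain ⟨j, hj, hlim⟩ := exists_seq_tendsto_cos ht
  have hlo := ((hlim.const_mul b).const_add a).abs
  rw [hwt] at hlo
  refine tendsto_of_tendsto_of_tendsto_of_le_of_le' hlo tendsto_const_nhds ?_ ?_
  · filter_upwards [eventually_ge_atTop 1] with n hn
    exact le_ciSup (Set.finite_range fun i : (Finset.Icc 1 n : Finset ℕ) =>
      |a + b * Real.cos (Real.pi * ((i : ℕ) : ℝ) / ((n : ℝ) + 1))|).bddAbove ⟨j n, hj n hn⟩
  · filter_upwards [eventually_ge_atTop 1] with n hn
    have : Nonempty (Finset.Icc 1 n : Finset ℕ) := ⟨⟨j n, hj n hn⟩⟩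
    exact ciSup_le fun i => hw _ (Real.cos_mem_Icc _)

theorem abs_add_mul_le_max {a b s : ℝ} (hb : 0 ≤ b) (hs : s ∈ Set.Icc (-1 : ℝ) 1) :
    |a + b * s| ≤ max |a - b| |a + b| := by
  have h1 : -b ≤ b * s := by nlinarith [hs.1]
  have h2 : b * s ≤ b := by nlinarith [hs.2]
  rw [max_comm]
  refine abs_le.2 ⟨?_, ?_⟩
  · linarith [neg_abs_le (a - b), le_max_right |a + b| |a - b|]
  · linarith [le_abs_self (a + b), le_max_left |a + b| |a - b|]

theorem exists_abs_add_mul_eq_max (a b : ℝ) :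
    ∃ t ∈ Set.Icc (-1 : ℝ) 1, |a + b * t| = max |a - b| |a + b| := by
  rcases max_choice |a - b| |a + b| with h | h
  · exact ⟨-1, by norm_num, by rw [h]; ring_nf⟩
  · exact ⟨1, by norm_num, by rw [h]; ring_nf⟩

theorem ite_min_le_abs_add_mul {a b s : ℝ} (hb : 0 ≤ b) (hs : s ∈ Set.Icc (-1 : ℝ) 1) :
    (if |a| ≤ b then (0 : ℝ) else min |a - b| |a + b|) ≤ |a + b * s| := by
  have h1 : -b ≤ b * s := by nlinarith [hs.1]
  have h2 : b * s ≤ b := by nlinarith [hs.2]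
  split_ifs with h
  · exact abs_nonneg _
  · rcases lt_abs.1 (not_le.1 h) with h | h
    · refine (min_le_left _ _).trans ?_
      rw [abs_of_pos (by linarith), abs_of_pos (by linarith)]
      linarith
    · refine (min_le_right _ _).trans ?_
      rw [abs_of_neg (by linarith), abs_of_neg (by linarith)]
      linarith

theorem exists_abs_add_mul_eq_ite_min (a b : ℝ) :
    ∃ t ∈ Set.Icc (-1 : ℝ) 1,
      |a + b * t| = if |a| ≤ b then (0 : ℝ) else min |a - b| |a + b| := by
  split_ifs with h
  · rcases ((abs_nonneg a).trans h).eq_or_lt with hb | hb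
    · refine ⟨0, by norm_num, ?_⟩
      rw [← hb] at h
      simpa using h
    · have hab := abs_le.1 h
      refine ⟨-a / b, ⟨?_, ?_⟩, ?_⟩
      · rw [le_div_iff₀ hb]
        linarith
      · rw [div_le_iff₀ hb]
        linarith
      · rw [mul_div_cancel₀ _ hb.ne']
        simp
  · rcases min_choice |a - b| |a + b| with h | h
    · exact ⟨-1, by norm_num, by rw [h]; ring_nf⟩
    · exact ⟨1, by norm_num, by rw [h]; ring_nf⟩

section

variable {Ω : Type*}

theorem tendsto_symSmin (X Y : Ω → ℝ) (ω : Ω) :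
    Tendsto (fun n => symSmin X Y n ω) atTop
      (nhds (if |X ω| ≤ 2 * |Y ω| then (0 : ℝ)
        else min (abs (X ω - 2 * |Y ω|)) (abs (X ω + 2 * |Y ω|)))) := by
  obtain ⟨t, ht, h⟩ := exists_abs_add_mul_eq_ite_min (X ω) (2 * |Y ω|)
  exact tendsto_iInf_abs_add_mul_cos ht h fun s hs => ite_min_le_abs_add_mul (by positivity) hs

theorem tendsto_symSmax (X Y : Ω → ℝ) (ω : Ω) :
    Tendsto (fun n => symSmax X Y n ω) atTop
      (nhds (max (abs (X ω - 2 * |Y ω|)) (abs (X ω + 2 * |Y ω|)))) := by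
  obtain ⟨t, ht, h⟩ := exists_abs_add_mul_eq_max (X ω) (2 * |Y ω|)
  exact tendsto_iSup_abs_add_mul_cos ht h fun s hs => abs_add_mul_le_max (by positivity) hs

theorem symSmax_le (X Y : Ω → ℝ) (n : ℕ) (ω : Ω) :
    symSmax X Y n ω ≤ max (abs (X ω - 2 * |Y ω|)) (abs (X ω + 2 * |Y ω|)) :=
  Real.iSup_le (fun _ => abs_add_mul_le_max (by positivity) (Real.cos_mem_Icc _))
    ((abs_nonneg _).trans (le_max_left _ _))

variable [MeasurableSpace Ω] {X Y : Ω → ℝ}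

theorem measurable_symSmin (hX : Measurable X) (hY : Measurable Y) (n : ℕ) :
    Measurable (symSmin X Y n) := by
  unfold symSmin
  exact Measurable.iInf fun j => by fun_prop

theorem measurable_symSmax (hX : Measurable X) (hY : Measurable Y) (n : ℕ) :
    Measurable (symSmax X Y n) := by
  unfold symSmax
  exact Measurable.iSup fun j => by fun_prop

end

theorem stmt6 {Ω : Type*} [MeasureSpace Ω] [IsProbabilityMeasure (ℙ : Measure Ω)]
    (X Y : Ω → ℝ) (hX : Measurable X) (hY : Measurable Y) (x y : ℝ)
    (hx : ℙ {ω | (if |X ω| ≤ 2 * |Y ω| then (0 : ℝ)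
        else min (abs (X ω - 2 * |Y ω|)) (abs (X ω + 2 * |Y ω|))) = x} = 0) :
    Tendsto
      (fun n : ℕ => (ℙ {ω | symSmin X Y n ω ≤ x ∧ symSmax X Y n ω ≤ y}).toReal)
      atTop
      (nhds ((ℙ {ω | max (abs (X ω - 2 * |Y ω|)) (abs (X ω + 2 * |Y ω|)) ≤ y}).toReal
        - (ℙ {ω | x < 0 ∧ 0 ≤ max (abs (X ω - 2 * |Y ω|)) (abs (X ω + 2 * |Y ω|))
            ∧ max (abs (X ω - 2 * |Y ω|)) (abs (X ω + 2 * |Y ω|)) ≤ y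
            ∧ |X ω| ≤ 2 * |Y ω|}).toReal
        - (ℙ {ω | x < min (abs (X ω - 2 * |Y ω|)) (abs (X ω + 2 * |Y ω|))
            ∧ min (abs (X ω - 2 * |Y ω|)) (abs (X ω + 2 * |Y ω|))
              ≤ max (abs (X ω - 2 * |Y ω|)) (abs (X ω + 2 * |Y ω|))
            ∧ max (abs (X ω - 2 * |Y ω|)) (abs (X ω + 2 * |Y ω|)) ≤ y
            ∧ 2 * |Y ω| < |X ω|}).toReal)) := by
  set m : Ω → ℝ := fun ω => min (abs (X ω - 2 * |Y ω|)) (abs (X ω + 2 * |Y ω|)) with hm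
  set M : Ω → ℝ := fun ω => max (abs (X ω - 2 * |Y ω|)) (abs (X ω + 2 * |Y ω|)) with hM
  set W : Ω → ℝ := fun ω => if |X ω| ≤ 2 * |Y ω| then (0 : ℝ) else m ω with hW
  have hmM : ∀ ω, m ω ≤ M ω := fun ω => min_le_max
  have hM0 : ∀ ω, 0 ≤ M ω := fun ω => (abs_nonneg _).trans (le_max_left _ _)
  have hmmeas : Measurable m := by fun_prop
  have hMmeas : Measurable M := by fun_prop
  have hXY : MeasurableSet {ω | |X ω| ≤ 2 * |Y ω|} :=
    measurableSet_le (by fun_prop) (by fun_prop)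
  have hWmeas : Measurable W := Measurable.ite hXY measurable_const hmmeas
  have hlim : Tendsto (fun n : ℕ => ℙ {ω | symSmin X Y n ω ≤ x ∧ symSmax X Y n ω ≤ y})
      atTop (nhds (ℙ {ω | W ω ≤ x ∧ M ω ≤ y})) := by
    refine tendsto_measure_of_ae_tendsto_indicator_of_isFiniteMeasure atTop
      ((measurableSet_le hWmeas measurable_const).inter
        (measurableSet_le hMmeas measurable_const))
      (fun n => (measurableSet_le (measurable_symSmin hX hY n) measurable_const).inter
        (measurableSet_le (measurable_symSmax hX hY n) measurable_const)) ?_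
    have hne : ∀ᵐ ω ∂(ℙ : Measure Ω), W ω ≠ x := by
      rw [ae_iff]
      simpa using hx
    filter_upwards [hne] with ω hω
    have hS : Tendsto (fun n => symSmin X Y n ω) atTop (nhds (W ω)) := tendsto_symSmin X Y ω
    have hL : Tendsto (fun n => symSmax X Y n ω) atTop (nhds (M ω)) := tendsto_symSmax X Y ω
    by_cases hy : M ω ≤ y
    · rcases lt_or_gt_of_ne hω with h | h
      · filter_upwards [hS.eventually_lt_const h] with n hn
        exact iff_of_true ⟨hn.le, (symSmax_le X Y n ω).trans hy⟩ ⟨h.le, hy⟩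
      · filter_upwards [hS.eventually_const_lt h] with n hn
        exact iff_of_false (fun h' => hn.not_ge h'.1) (fun h' => h.not_ge h'.1)
    · filter_upwards [hL.eventually_const_lt (not_le.1 hy)] with n hn
      exact iff_of_false (fun h' => hn.not_ge h'.2) (fun h' => hy h'.2)
  have hreal := (ENNReal.tendsto_toReal (measure_ne_top ℙ {ω | W ω ≤ x ∧ M ω ≤ y})).comp hlim
  set A : Set Ω := {ω | x < 0 ∧ 0 ≤ M ω ∧ M ω ≤ y ∧ |X ω| ≤ 2 * |Y ω|} with hA
  set B : Set Ω := {ω | x < m ω ∧ m ω ≤ M ω ∧ M ω ≤ y ∧ 2 * |Y ω| < |X ω|} with hB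
  have hBmeas : MeasurableSet B :=
    (measurableSet_lt measurable_const hmmeas).inter
      ((measurableSet_le hmmeas hMmeas).inter
        ((measurableSet_le hMmeas measurable_const).inter
          (measurableSet_lt (hY.abs.const_mul 2) hX.abs)))
  have hAB : Disjoint A B :=
    Set.disjoint_left.2 fun ω ha hb => hb.2.2.2.not_ge ha.2.2.2
  have hAmeas : MeasurableSet A :=
    (MeasurableSet.const _).inter ((measurableSet_le measurable_const hMmeas).inter
      ((measurableSet_le hMmeas measurable_const).inter hXY))
  have hsub : A ∪ B ⊆ {ω | M ω ≤ y} := by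
    rintro ω (h | h)
    · exact h.2.2.1
    · exact h.2.2.1
  have hdiff : {ω | M ω ≤ y} \ (A ∪ B) = {ω | W ω ≤ x ∧ M ω ≤ y} := by
    ext ω
    have h1 := hmM ω
    have h2 := hM0 ω
    simp only [hA, hB, hW, Set.mem_sdiff, Set.mem_union, Set.mem_ofPred_eq]
    split_ifs with h
    · have h3 := h.not_gt
      grind
    · have h3 := not_le.1 h
      grind
  have h1 := measureReal_sdiff (μ := (ℙ : Measure Ω)) hsub (hAmeas.union hBmeas)
  rw [hdiff, measureReal_union hAB hBmeas] at h1
  simp only [Measure.real] at h1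
  rw [h1, ← sub_sub] at hreal
  exact hreal
end

section
/- Let X and Y be independent standard normal random variables, let φ(t) = (1/√(2π))·exp(−t²/2) be the standard normal density and Φ its cumulative distribution function, and let M := max(|X−2|Y||, |X+2|Y||). Then for every y ≥ 0: P(M ≤ y) = 2·∫₀^{y/2} [Φ(y−2v) − Φ(2v−y)]·φ(v) dv, and P(M ≤ y) = 0 for y < 0. -/
open MeasureTheory ProbabilityTheory

/-- The standard normal density `φ(t) = (1/√(2π))·exp(−t²/2)`. -/
noncomputable def stdGaussianPDF (t : ℝ) : ℝ :=
  (Real.sqrt (2 * Real.pi))⁻¹ * Real.exp (-t ^ 2 / 2)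

/-- The standard normal cumulative distribution function `Φ`. -/
noncomputable def stdGaussianCDF (t : ℝ) : ℝ :=
  ∫ s in Set.Iic t, stdGaussianPDF s

lemma stdGaussianPDF_eq (t : ℝ) : stdGaussianPDF t = gaussianPDFReal 0 1 t := by
  simp [stdGaussianPDF, gaussianPDFReal]

lemma stdGaussianPDF_abs (t : ℝ) : stdGaussianPDF |t| = stdGaussianPDF t := by
  simp [stdGaussianPDF]

lemma stdGaussianCDF_eq (t : ℝ) : stdGaussianCDF t = (gaussianReal 0 1).real (Set.Iic t) := by
  rw [measureReal_def, gaussianReal_apply_eq_integral _ one_ne_zero, ENNReal.toReal_ofReal]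
  · simp only [stdGaussianCDF, stdGaussianPDF_eq]
  · exact integral_nonneg fun x => gaussianPDFReal_nonneg _ _ _

lemma gaussianReal_real_Icc {a b : ℝ} (hab : a ≤ b) :
    (gaussianReal 0 1).real (Set.Icc a b) = stdGaussianCDF b - stdGaussianCDF a := by
  have := nullSingletonClass_gaussianReal (μ := 0) one_ne_zero
  rw [stdGaussianCDF_eq, stdGaussianCDF_eq, ← measureReal_sdiff (Set.Iic_subset_Iic.2 hab)
    measurableSet_Iic, Set.Iic_sdiff_Iic]
  exact measureReal_congr Ioc_ae_eq_Icc.symm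

lemma max_abs_sub_abs_add (a : ℝ) {b : ℝ} (hb : 0 ≤ b) :
    max |a - b| |a + b| = |a| + b := by
  grind

lemma gaussianReal_prod_real_abs_add_le (y : ℝ) (hy : 0 ≤ y) :
    ((gaussianReal 0 1).prod (gaussianReal 0 1)).real {p : ℝ × ℝ | |p.1| + 2 * |p.2| ≤ y}
      = 2 * ∫ v in (0 : ℝ)..(y / 2),
          (stdGaussianCDF (y - 2 * v) - stdGaussianCDF (2 * v - y)) * stdGaussianPDF v := by
  have hS : MeasurableSet {p : ℝ × ℝ | |p.1| + 2 * |p.2| ≤ y} :=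
    measurableSet_le (by fun_prop) measurable_const
  have hsec (v : ℝ) : (fun x => (x, v)) ⁻¹' {p : ℝ × ℝ | |p.1| + 2 * |p.2| ≤ y}
      = Set.Icc (2 * |v| - y) (y - 2 * |v|) := by
    ext x
    simp only [Set.mem_preimage, Set.mem_ofPred_eq, Set.mem_Icc]
    grind
  have hint : ((gaussianReal 0 1).prod (gaussianReal 0 1)).real
      {p : ℝ × ℝ | |p.1| + 2 * |p.2| ≤ y}
      = ∫ v, (gaussianReal 0 1).real (Set.Icc (2 * |v| - y) (y - 2 * |v|)) ∂gaussianReal 0 1 := by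
    rw [measureReal_def, Measure.prod_apply_symm hS, ← integral_toReal
      (measurable_measure_prodMk_right hS).aemeasurable (by simp [measure_lt_top])]
    simp only [hsec, measureReal_def]
  rw [hint, integral_gaussianReal_eq_integral_smul one_ne_zero]
  simp only [smul_eq_mul, ← stdGaussianPDF_eq]
  have habs := integral_comp_abs (f := fun v => stdGaussianPDF v *
    (gaussianReal 0 1).real (Set.Icc (2 * v - y) (y - 2 * v)))
  simp only [stdGaussianPDF_abs] at habs
  rw [habs, intervalIntegral.integral_of_le (by positivity),
    setIntegral_eq_of_subset_of_forall_sdiff_eq_zero measurableSet_Ioi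
      (Set.Ioc_subset_Ioi_self : Set.Ioc 0 (y / 2) ⊆ Set.Ioi 0)]
  · congr 1
    refine setIntegral_congr_fun measurableSet_Ioc fun v hv => ?_
    have := hv.2
    rw [gaussianReal_real_Icc (by linarith), mul_comm]
  · intro v hv
    have : y / 2 < v := by
      by_contra! h
      exact hv.2 ⟨hv.1, h⟩
    rw [Set.Icc_eq_empty (by linarith)]
    simp

theorem stmt14 {Ω : Type*} [MeasureSpace Ω] [IsProbabilityMeasure (ℙ : Measure Ω)]
    (X Y : Ω → ℝ) (hX : Measurable X) (hY : Measurable Y)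
    (hXlaw : Measure.map X ℙ = gaussianReal 0 1)
    (hYlaw : Measure.map Y ℙ = gaussianReal 0 1)
    (hindep : IndepFun X Y ℙ) (y : ℝ) :
    (0 ≤ y →
      (ℙ {ω | max (abs (X ω - 2 * |Y ω|)) (abs (X ω + 2 * |Y ω|)) ≤ y}).toReal
        = 2 * ∫ v in (0 : ℝ)..(y / 2),
            (stdGaussianCDF (y - 2 * v) - stdGaussianCDF (2 * v - y)) * stdGaussianPDF v) ∧
    (y < 0 →
      ℙ {ω | max (abs (X ω - 2 * |Y ω|)) (abs (X ω + 2 * |Y ω|)) ≤ y} = 0) := by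
  have hM (ω : Ω) : max (abs (X ω - 2 * |Y ω|)) (abs (X ω + 2 * |Y ω|)) = |X ω| + 2 * |Y ω| :=
    max_abs_sub_abs_add _ (by positivity)
  simp only [hM]
  refine ⟨fun hy => ?_, fun hy => ?_⟩
  · rw [← gaussianReal_prod_real_abs_add_le y hy]
    have hmap := (indepFun_iff_map_prod_eq_prod_map_map hX.aemeasurable hY.aemeasurable).1 hindep
    rw [hXlaw, hYlaw] at hmap
    rw [← hmap, measureReal_def, Measure.map_apply (hX.prodMk hY)
      (measurableSet_le (by fun_prop) measurable_const)]
    rfl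
  · convert measure_empty (μ := (ℙ : Measure Ω))
    ext ω
    simp only [Set.mem_ofPred_eq, Set.mem_empty_iff_false, iff_false, not_le]
    exact hy.trans_le (by positivity)
end
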